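/- arXiv:2401.04041 — 2 statements merged into one kernel-verified Lean document; each statement's English description precedes it below -/
import Mathlib

section
/- Let r ∈ (1,2) and t₀ ∈ ℝ. Define u : ℝ → ℝ by u(t) = (2r/(2−r)²)^{1/(r−2)} (t−t₀)^{2/(2−r)} for t > t₀ and u(t) = 0 for t ≤ t₀. Then u is continuously differentiable, twice differentiable on all of ℝ, not identically zero, vanishes on (−∞, t₀], and satisfies −u''(t) + |u(t)|^{r−2}u(t) = 0 for all t ∈ ℝ (where |u|^{r−2}u is interpreted as 0 at points where u = 0). -/
/-- For `p > 1`, the truncated power `x ↦ (max x 0) ^ p` is differentiable on all of `ℝ`. -/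
theorem hasDerivAt_max_zero_rpow {p : ℝ} (hp : 1 < p) (x : ℝ) :
    HasDerivAt (fun y : ℝ => max y 0 ^ p) (p * max x 0 ^ (p - 1)) x := by
  have h_zero : ∀ y : ℝ, y ≤ 0 → max y 0 ^ p = 0 := fun y hy => by
    rw [max_eq_right hy, Real.zero_rpow (by linarith)]
  have h_deriv_zero : ∀ y : ℝ, y ≤ 0 → p * max y 0 ^ (p - 1) = 0 := fun y hy => by
    rw [max_eq_right hy, Real.zero_rpow (by linarith), mul_zero]
  rcases lt_trichotomy x 0 with hx | rfl | hx
  · rw [h_deriv_zero x hx.le]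
    refine (hasDerivAt_const x (0 : ℝ)).congr_of_eventuallyEq ?_
    filter_upwards [Iio_mem_nhds hx] with y hy using h_zero y (le_of_lt hy)
  · rw [h_deriv_zero 0 le_rfl, ← hasDerivWithinAt_univ, ← Set.Iic_union_Ici (a := (0 : ℝ))]
    refine HasDerivWithinAt.union ?_ ?_
    · exact (hasDerivWithinAt_const (0 : ℝ) _ (0 : ℝ)).congr h_zero (h_zero 0 le_rfl)
    · have h := (Real.hasDerivAt_rpow_const (x := 0) (p := p) (Or.inr hp.le)).hasDerivWithinAt
        (s := Set.Ici (0 : ℝ))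
      rw [Real.zero_rpow (by linarith), mul_zero] at h
      exact h.congr (fun y hy => by rw [max_eq_left hy]) (by rw [max_self])
  · rw [max_eq_left hx.le]
    refine (Real.hasDerivAt_rpow_const (Or.inl hx.ne')).congr_of_eventuallyEq ?_
    filter_upwards [Ioi_mem_nhds hx] with y hy
    rw [max_eq_left (le_of_lt hy)]

/-- Derivative of a scaled and translated truncated power. -/
theorem hasDerivAt_const_mul_max_sub_zero_rpow {p : ℝ} (hp : 1 < p) (c a x : ℝ) :
    HasDerivAt (fun y : ℝ => c * max (y - a) 0 ^ p) (c * p * max (x - a) 0 ^ (p - 1)) x := by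
  rw [mul_assoc]
  exact ((hasDerivAt_max_zero_rpow hp (x - a)).comp_sub_const x a).const_mul c

/-- For `r ∈ (1,2)` and `t₀ ∈ ℝ`, the function
`u(t) = (2r/(2-r)²)^{1/(r-2)} (t-t₀)^{2/(2-r)}` for `t > t₀` and `u(t) = 0` for `t ≤ t₀`
is continuously differentiable, twice differentiable on all of `ℝ`, not identically zero,
vanishes on `(-∞, t₀]`, and solves `-u'' + |u|^{r-2}u = 0` on all of `ℝ`
(with `|u|^{r-2}u` interpreted as `0` where `u = 0`, which is the rpow convention). -/
theorem sublinear_ode_counterexample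
    (r t₀ : ℝ) (hr1 : 1 < r) (hr2 : r < 2) (u : ℝ → ℝ)
    (hu : ∀ t, u t = if t₀ < t
        then (2 * r / (2 - r) ^ 2) ^ (1 / (r - 2)) * (t - t₀) ^ (2 / (2 - r))
        else 0) :
    ContDiff ℝ 1 u ∧
    Differentiable ℝ (deriv u) ∧
    (∃ t, u t ≠ 0) ∧
    (∀ t ≤ t₀, u t = 0) ∧
    (∀ t : ℝ, -(deriv (deriv u) t) + |u t| ^ (r - 2) * u t = 0) := by
  set K : ℝ := 2 * r / (2 - r) ^ 2 with hK
  set C : ℝ := K ^ (1 / (r - 2)) with hC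
  set p : ℝ := 2 / (2 - r) with hp
  have h_pos : 0 < 2 - r := by linarith
  have h_ne : 2 - r ≠ 0 := h_pos.ne'
  have h_two_lt : 2 < p := by rw [hp, lt_div_iff₀ h_pos]; linarith
  have hK_pos : 0 < K := by positivity
  have hC_pos : 0 < C := Real.rpow_pos_of_pos hK_pos _
  have hpK : p * (p - 1) = K := by rw [hp, hK]; field_simp; ring
  have hC_rpow : C ^ (r - 2) = K := by
    rw [hC, ← Real.rpow_mul hK_pos.le, one_div_mul_cancel (by linarith), Real.rpow_one]
  have h_exp : p * (r - 2) = -2 := by rw [hp]; field_simp; ring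
  have hu_zero : ∀ t ≤ t₀, u t = 0 := fun t ht => by rw [hu, if_neg ht.not_gt]
  have hu_eq : u = fun t => C * max (t - t₀) 0 ^ p := by
    funext t
    rcases lt_or_ge t₀ t with ht | ht
    · rw [hu, if_pos ht, max_eq_left (sub_nonneg.2 ht.le)]
    · rw [hu_zero t ht, max_eq_right (sub_nonpos.2 ht), Real.zero_rpow (by linarith), mul_zero]
  have h_deriv : ∀ t, HasDerivAt u (C * p * max (t - t₀) 0 ^ (p - 1)) t := fun t => by
    rw [hu_eq]
    exact hasDerivAt_const_mul_max_sub_zero_rpow (by linarith) C t₀ t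
  have h_deriv_eq : deriv u = fun t => C * p * max (t - t₀) 0 ^ (p - 1) :=
    funext fun t => (h_deriv t).deriv
  have h_deriv2 : ∀ t, HasDerivAt (deriv u)
      (C * p * (p - 1) * max (t - t₀) 0 ^ (p - 1 - 1)) t := fun t => by
    rw [h_deriv_eq]
    exact hasDerivAt_const_mul_max_sub_zero_rpow (by linarith) (C * p) t₀ t
  have h_diff : Differentiable ℝ (deriv u) := fun t => (h_deriv2 t).differentiableAt
  refine ⟨contDiff_one_iff_deriv.2 ⟨fun t => (h_deriv t).differentiableAt, h_diff.continuous⟩,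
    h_diff, ⟨t₀ + 1, ?_⟩, hu_zero, fun t => ?_⟩
  · rw [hu, if_pos (lt_add_one t₀), add_sub_cancel_left, Real.one_rpow, mul_one]
    exact hC_pos.ne'
  · rw [(h_deriv2 t).deriv]
    rcases lt_or_ge t₀ t with ht | ht
    · have hs : 0 < t - t₀ := sub_pos.2 ht
      have hs_pow : 0 < (t - t₀) ^ p := Real.rpow_pos_of_pos hs p
      rw [hu, if_pos ht, max_eq_left hs.le, abs_of_pos (mul_pos hC_pos hs_pow),
        Real.mul_rpow hC_pos.le hs_pow.le, ← Real.rpow_mul hs.le, hC_rpow, h_exp, ← hpK,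
        show p - 1 - 1 = -2 + p by ring, Real.rpow_add hs]
      ring
    · rw [hu_zero t ht, max_eq_right (sub_nonpos.2 ht), Real.zero_rpow (by linarith)]
      simp
end

section
/- Let 1 < s < 2 < r, let u₀ > 0 be such that δ := 2/s − (2/r)u₀^{r−s} > 0. Then 2/s + τ^{2−s} − (2/r)τ^{r−s} ≥ δ for all τ ∈ (0, u₀], and consequently T := ∫_0^{u₀} τ^{−s/2} (2/s + τ^{2−s} − (2/r)τ^{r−s})^{−1/2} dτ ≤ δ^{−1/2} · u₀^{1−s/2}/(1−s/2) < ∞. -/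
open MeasureTheory Set

/-- Let `1 < s < 2 < r` and `u₀ > 0` with
`δ := 2/s − (2/r)u₀^{r−s} > 0`. Then `2/s + τ^{2−s} − (2/r)τ^{r−s} ≥ δ` for all
`τ ∈ (0, u₀]`, and consequently the integrand `τ^{−s/2}(2/s + τ^{2−s} − (2/r)τ^{r−s})^{−1/2}`
is integrable on `(0, u₀]` with
`T = ∫_0^{u₀} τ^{−s/2}(2/s + τ^{2−s} − (2/r)τ^{r−s})^{−1/2} dτ ≤ δ^{−1/2} u₀^{1−s/2}/(1−s/2) < ∞`. -/
theorem time_to_zero_finite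
    (s r u₀ δ : ℝ) (hs1 : 1 < s) (hs2 : s < 2) (hr : 2 < r) (hu₀ : 0 < u₀)
    (hδ : δ = 2 / s - (2 / r) * u₀ ^ (r - s)) (hδpos : 0 < δ) :
    (∀ τ ∈ Set.Ioc (0 : ℝ) u₀, δ ≤ 2 / s + τ ^ (2 - s) - (2 / r) * τ ^ (r - s)) ∧
    MeasureTheory.IntegrableOn
      (fun τ : ℝ => τ ^ (-(s / 2)) *
        (2 / s + τ ^ (2 - s) - (2 / r) * τ ^ (r - s)) ^ (-(1 : ℝ) / 2))
      (Set.Ioc (0 : ℝ) u₀) ∧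
    (∫ τ in Set.Ioc (0 : ℝ) u₀,
        τ ^ (-(s / 2)) * (2 / s + τ ^ (2 - s) - (2 / r) * τ ^ (r - s)) ^ (-(1 : ℝ) / 2))
      ≤ δ ^ (-(1 : ℝ) / 2) * (u₀ ^ (1 - s / 2) / (1 - s / 2)) := by
  have lower : ∀ τ ∈ Set.Ioc (0 : ℝ) u₀,
      δ ≤ 2 / s + τ ^ (2 - s) - (2 / r) * τ ^ (r - s) := by
    intro τ hτ
    have h1 : τ ^ (r - s) ≤ u₀ ^ (r - s) :=
      Real.rpow_le_rpow hτ.1.le hτ.2 (by linarith)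
    have h2 : 0 ≤ τ ^ (2 - s) := Real.rpow_nonneg hτ.1.le _
    have h3 : (2 / r) * τ ^ (r - s) ≤ (2 / r) * u₀ ^ (r - s) :=
      mul_le_mul_of_nonneg_left h1 (by positivity)
    linarith
  have bound : ∀ τ ∈ Set.Ioc (0 : ℝ) u₀,
      τ ^ (-(s / 2)) * (2 / s + τ ^ (2 - s) - (2 / r) * τ ^ (r - s)) ^ (-(1 : ℝ) / 2)
        ≤ δ ^ (-(1 : ℝ) / 2) * τ ^ (-(s / 2)) := by
    intro τ hτ
    rw [mul_comm]
    exact mul_le_mul_of_nonneg_right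
      (Real.rpow_le_rpow_of_nonpos hδpos (lower τ hτ) (by norm_num))
      (Real.rpow_nonneg hτ.1.le _)
  have dominating : IntegrableOn (fun τ : ℝ => δ ^ (-(1 : ℝ) / 2) * τ ^ (-(s / 2)))
      (Set.Ioc (0 : ℝ) u₀) :=
    ((intervalIntegrable_iff_integrableOn_Ioc_of_le hu₀.le).1
      (intervalIntegral.intervalIntegrable_rpow' (by linarith))).const_mul _
  have integrable : IntegrableOn
      (fun τ : ℝ => τ ^ (-(s / 2)) *
        (2 / s + τ ^ (2 - s) - (2 / r) * τ ^ (r - s)) ^ (-(1 : ℝ) / 2))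
      (Set.Ioc (0 : ℝ) u₀) := by
    refine Integrable.mono' dominating (by fun_prop) ?_
    refine (ae_restrict_iff' measurableSet_Ioc).2 (ae_of_all _ fun τ hτ => ?_)
    rw [Real.norm_of_nonneg (mul_nonneg (Real.rpow_nonneg hτ.1.le _)
      (Real.rpow_nonneg (hδpos.le.trans (lower τ hτ)) _))]
    exact bound τ hτ
  refine ⟨lower, integrable,
    (setIntegral_mono_on integrable dominating measurableSet_Ioc bound).trans_eq ?_⟩
  rw [integral_const_mul, ← intervalIntegral.integral_of_le hu₀.le,
    integral_rpow (Or.inl (by linarith)), show -(s / 2) + 1 = 1 - s / 2 by ring,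
    Real.zero_rpow (by linarith), sub_zero]
end
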